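/- arXiv:1101.1110 — 4 statements merged into one kernel-verified Lean document; each statement's English description precedes it below -/
import Mathlib

section
/- Let K be a commutative semiring whose addition is idempotent (k + k = k for all k ∈ K) and let M be an additive commutative monoid. If M is compatible with K (i.e., ι : M → K ⊗[ℕ] M is injective), then the addition of M is idempotent: m + m = m for all m ∈ M. -/
open TensorProduct

/-- If the addition of the commutative semiring `K` is idempotent and
`ι : M → K ⊗[ℕ] M`, `ι m = 1 ⊗ₜ m`, is injective (i.e. `M` is compatible with `K`), then
the addition of `M` is idempotent. -/
theorem idempotent_of_compatible_idempotent_semiring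
    (K : Type*) [CommSemiring K] (M : Type*) [AddCommMonoid M]
    (hK : ∀ k : K, k + k = k)
    (hι : Function.Injective
      (fun m : M => ((1 : K) ⊗ₜ[ℕ] m : K ⊗[ℕ] M))) :
    ∀ m : M, m + m = m := by
  intro m
  apply hι
  change (1 : K) ⊗ₜ[ℕ] (m + m) = (1 : K) ⊗ₜ[ℕ] m
  rw [TensorProduct.tmul_add, ← TensorProduct.add_tmul, hK]
end

section
/- Let K be a commutative semiring such that there exists a semiring homomorphism from K to the natural numbers ℕ. Then K is compatible with every additive commutative monoid M; that is, for every additive commutative monoid M the map ι : M → K ⊗[ℕ] M given by ι(m) = 1 ⊗ₜ m is injective. -/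
open TensorProduct

/-- If there exists a semiring homomorphism from `K` to `ℕ`, then `K` is
compatible with every additive commutative monoid `M`: the map
`ι : M → K ⊗[ℕ] M`, `ι m = 1 ⊗ₜ m`, is injective. -/
theorem compatible_of_homomorphism_to_nat
    (K : Type*) [CommSemiring K] (hhom : Nonempty (K →+* ℕ))
    (M : Type*) [AddCommMonoid M] :
    Function.Injective (fun m : M => ((1 : K) ⊗ₜ[ℕ] m : K ⊗[ℕ] M)) := by
  obtain ⟨f⟩ := hhom
  let retraction : K ⊗[ℕ] M →ₗ[ℕ] M :=
    TensorProduct.lid ℕ M ∘ₗ LinearMap.rTensor M f.toAddMonoidHom.toNatLinearMap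
  refine Function.LeftInverse.injective (g := retraction) fun m => ?_
  change f 1 • m = m
  rw [map_one, one_smul]
end

section
/- For every type X of provenance tokens and every additive commutative monoid M, the semiring ℕ[X] of multivariate polynomials with natural number coefficients is compatible with M: the map ι : M → (ℕ[X]) ⊗[ℕ] M given by ι(m) = 1 ⊗ₜ m is injective. -/
open TensorProduct

/-- The semiring `ℕ[X]` of provenance polynomials (multivariate polynomials with
natural number coefficients) is compatible with every additive commutative monoid `M`:
`ι : M → ℕ[X] ⊗[ℕ] M`, `ι m = 1 ⊗ₜ m`, is injective. -/
theorem provenance_polynomials_compatible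
    (X : Type*) (M : Type*) [AddCommMonoid M] :
    Function.Injective
      (fun m : M =>
        ((1 : MvPolynomial X ℕ) ⊗ₜ[ℕ] m : (MvPolynomial X ℕ) ⊗[ℕ] M)) := by
  refine Function.LeftInverse.injective (g := fun t =>
    TensorProduct.lid ℕ M
      ((MvPolynomial.aeval (fun _ : X => (0 : ℕ))).toLinearMap.rTensor M t)) fun m => ?_
  simp
end

section
/- Let K be a commutative semiring in which 0 ≠ 1, every element equals 0 or 1, and 1 + 1 = 1 (so K plays the role of the boolean semiring 𝔹), and let M be an additive commutative monoid whose addition is idempotent (m + m = m for all m). Then ι : M → K ⊗[ℕ] M, ι(m) = 1 ⊗ₜ m, is a bijection; in particular it is an isomorphism of additive monoids. (This yields the cases 𝔹 ⊗ MAX and 𝔹 ⊗ MIN of the paper's familiarity proposition.) -/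
open TensorProduct

open Classical in
/-- The additive action of a two-element semiring with `1 + 1 = 1` on an additive commutative
monoid with idempotent addition: `0` acts as zero and `1` as the identity. -/
noncomputable def booleanActionHom {K M : Type*} [CommSemiring K] [AddCommMonoid M]
    (h01 : (0 : K) ≠ 1) (hall : ∀ k : K, k = 0 ∨ k = 1) (hidem : (1 : K) + 1 = 1)
    (hM : ∀ m : M, m + m = m) : K →+ M →+ M where
  toFun k := if k = 0 then 0 else AddMonoidHom.id M
  map_zero' := if_pos rfl
  map_add' a b := by
    ext m
    rcases hall a with rfl | rfl <;> rcases hall b with rfl | rfl <;>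
      simp [hidem, h01.symm, hM]

theorem booleanActionHom_one {K M : Type*} [CommSemiring K] [AddCommMonoid M]
    (h01 : (0 : K) ≠ 1) (hall : ∀ k : K, k = 0 ∨ k = 1) (hidem : (1 : K) + 1 = 1)
    (hM : ∀ m : M, m + m = m) (m : M) : booleanActionHom h01 hall hidem hM 1 m = m := by
  simp [booleanActionHom, h01.symm]

/-- If `K` is a commutative semiring with `0 ≠ 1`, every element equal to `0` or
`1`, and `1 + 1 = 1` (i.e. `K` is the boolean semiring `𝔹`), and the addition of `M` is
idempotent, then `ι : M → K ⊗[ℕ] M`, `ι m = 1 ⊗ₜ m`, is a bijection (hence an isomorphism of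
additive monoids, `ι` being an additive monoid homomorphism). -/
theorem iota_bijective_boolean_idempotent
    (K : Type*) [CommSemiring K] (M : Type*) [AddCommMonoid M]
    (h01 : (0 : K) ≠ 1) (hall : ∀ k : K, k = 0 ∨ k = 1)
    (hidem : (1 : K) + 1 = 1)
    (hM : ∀ m : M, m + m = m) :
    Function.Bijective (fun m : M => ((1 : K) ⊗ₜ[ℕ] m : K ⊗[ℕ] M)) := by
  constructor
  · let retraction : K ⊗[ℕ] M →+ M :=
      TensorProduct.liftAddHom (booleanActionHom h01 hall hidem hM) fun r k m => by
        rw [map_nsmul, map_nsmul, AddMonoidHom.nsmul_apply]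
    refine Function.LeftInverse.injective (g := retraction) fun m => ?_
    simp [retraction, booleanActionHom_one]
  · intro x
    induction x using TensorProduct.induction_on with
    | zero => exact ⟨0, tmul_zero M 1⟩
    | tmul k m =>
      rcases hall k with rfl | rfl
      · exact ⟨0, by simp⟩
      · exact ⟨m, rfl⟩
    | add x y hx hy =>
      obtain ⟨a, rfl⟩ := hx
      obtain ⟨b, rfl⟩ := hy
      exact ⟨a + b, tmul_add 1 a b⟩
end
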